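/- arXiv:1810.07585 — 5 statements merged into one kernel-verified Lean document; each statement's English description precedes it below -/
import Mathlib

section
/- For every path graph and every transaction matrix, the maximum of the profit function over all fee assignments with values in [0,1] is attained by a fee assignment whose fees are all either 0 or 1. That is, there exists f* ∈ {0,1}^m such that p(f*) ≥ p(f) for every f ∈ [0,1]^m. -/
/-- Total fee of the path from node `i` to node `j` (`i < j`) in the path graph,
using edges `i, i+1, …, j-1`. -/
def pathFee (f : ℕ → ℝ) (i j : ℕ) : ℝ := ∑ k ∈ Finset.Icc i (j - 1), f k

/-- Profit of the path graph on `n` nodes (edges `1,…,n-1`) with transaction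
matrix `T` and fee assignment `f`: a pair `(i,j)` with `i < j` contributes
`T i j` times its path fee whenever that fee is at most `1`, and `0` otherwise;
the number of edges `n-1` is subtracted. -/
noncomputable def pathProfit (n : ℕ) (T : ℕ → ℕ → ℕ) (f : ℕ → ℝ) : ℝ :=
  -((n - 1 : ℕ) : ℝ) +
    ∑ p ∈ (Finset.Icc 1 n ×ˢ Finset.Icc 1 n).filter (fun p => p.1 < p.2),
      (T p.1 p.2 : ℝ) * (if pathFee f p.1 p.2 ≤ 1 then pathFee f p.1 p.2 else 0)

theorem pathFee_eq_sum_range_sub (f : ℕ → ℝ) {i j : ℕ} (hij : i < j) :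
    pathFee f i j = ∑ k ∈ Finset.range j, f k - ∑ k ∈ Finset.range i, f k := by
  have h : Finset.Icc i (j - 1) = Finset.Ico i j := by
    ext k
    simp only [Finset.mem_Icc, Finset.mem_Ico]
    omega
  rw [pathFee, h, Finset.sum_Ico_eq_sub _ hij.le]

theorem pathProfit_congr {n : ℕ} (T : ℕ → ℕ → ℕ) {f g : ℕ → ℝ}
    (h : ∀ k ∈ Finset.Icc 1 (n - 1), f k = g k) : pathProfit n T f = pathProfit n T g := by
  unfold pathProfit
  congr 1
  refine Finset.sum_congr rfl fun p hp => ?_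
  simp only [Finset.mem_filter, Finset.mem_product, Finset.mem_Icc] at hp
  have : pathFee f p.1 p.2 = pathFee g p.1 p.2 := by
    refine Finset.sum_congr rfl fun k hk => h k ?_
    simp only [Finset.mem_Icc] at hk ⊢
    omega
  rw [this]

theorem intervalIntegrable_floor_add (x : ℝ) :
    IntervalIntegrable (fun t : ℝ => (⌊x + t⌋ : ℝ)) MeasureTheory.volume 0 1 := by
  refine Monotone.intervalIntegrable fun s t hst => ?_
  exact_mod_cast Int.floor_le_floor (by linarith : x + s ≤ x + t)

/-- The floor of a uniformly shifted real number has that number as its mean. -/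
theorem integral_floor_add (x : ℝ) : ∫ t in (0 : ℝ)..1, (⌊x + t⌋ : ℝ) = x := by
  have hper : Function.Periodic (fun t : ℝ => Int.fract t) 1 := fun t => Int.fract_add_one t
  have hfract : ∫ t in (0 : ℝ)..1, Int.fract (x + t) = 1 / 2 := by
    rw [intervalIntegral.integral_comp_add_left (fun t : ℝ => Int.fract t) x, add_zero,
      hper.intervalIntegral_add_eq x 0, zero_add]
    have : ∫ t in (0 : ℝ)..1, Int.fract t = ∫ t in (0 : ℝ)..1, t := by
      refine intervalIntegral.integral_congr_Ioo_of_le zero_le_one fun t ht => ?_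
      exact Int.fract_eq_self.2 ⟨ht.1.le, ht.2⟩
    rw [this, integral_id]
    norm_num
  have hlin : IntervalIntegrable (fun t : ℝ => x + t) MeasureTheory.volume 0 1 :=
    (by fun_prop : Continuous fun t : ℝ => x + t).intervalIntegrable 0 1
  have hsub := intervalIntegral.integral_sub hlin (intervalIntegrable_floor_add x)
  have hself : ∀ t : ℝ, x + t - (⌊x + t⌋ : ℝ) = Int.fract (x + t) := fun t => rfl
  simp only [hself] at hsub
  have hval : ∫ t in (0 : ℝ)..1, (x + t) = x + 1 / 2 := by
    rw [intervalIntegral.integral_add (by simp) (by simp)]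
    simp
  linarith

/-- Rounding of a fee assignment: the increments of the floors of its partial sums shifted by `t`. -/
noncomputable def roundedFee (f : ℕ → ℝ) (t : ℝ) (k : ℕ) : ℝ :=
  (⌊∑ i ∈ Finset.range (k + 1), f i + t⌋ : ℝ) - (⌊∑ i ∈ Finset.range k, f i + t⌋ : ℝ)

theorem pathFee_roundedFee (f : ℕ → ℝ) (t : ℝ) {i j : ℕ} (hij : i < j) :
    pathFee (roundedFee f t) i j =
      (⌊∑ k ∈ Finset.range j, f k + t⌋ : ℝ) - (⌊∑ k ∈ Finset.range i, f k + t⌋ : ℝ) := by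
  rw [pathFee_eq_sum_range_sub _ hij]
  simp only [roundedFee]
  rw [Finset.sum_range_sub (fun k => (⌊∑ i ∈ Finset.range k, f i + t⌋ : ℝ)),
    Finset.sum_range_sub (fun k => (⌊∑ i ∈ Finset.range k, f i + t⌋ : ℝ))]
  ring

theorem floor_sub_floor_le_one {a b : ℝ} (h : b - a ≤ 1) : (⌊b⌋ : ℝ) - (⌊a⌋ : ℝ) ≤ 1 := by
  have : ⌊b⌋ ≤ ⌊a⌋ + 1 := by
    rw [← Int.floor_add_one]
    exact Int.floor_le_floor (by linarith)
  have : (⌊b⌋ : ℝ) ≤ ⌊a⌋ + 1 := by exact_mod_cast this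
  linarith

theorem roundedFee_nonneg {f : ℕ → ℝ} {k : ℕ} (t : ℝ) (h : 0 ≤ f k) : 0 ≤ roundedFee f t k := by
  rw [roundedFee, sub_nonneg, Finset.sum_range_succ]
  exact_mod_cast Int.floor_le_floor (by linarith)

theorem roundedFee_eq_zero_or_one {f : ℕ → ℝ} {k : ℕ} (t : ℝ) (h0 : 0 ≤ f k) (h1 : f k ≤ 1) :
    roundedFee f t k = 0 ∨ roundedFee f t k = 1 := by
  have hnonneg := roundedFee_nonneg t h0
  have hle : roundedFee f t k ≤ 1 :=
    floor_sub_floor_le_one (by rw [Finset.sum_range_succ]; linarith)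
  rw [roundedFee] at *
  norm_cast at *
  omega

theorem le_pathProfit_roundedFee {n : ℕ} (T : ℕ → ℕ → ℕ) {f : ℕ → ℝ}
    (hf : ∀ k ∈ Finset.Icc 1 (n - 1), 0 ≤ f k) (t : ℝ) :
    -((n - 1 : ℕ) : ℝ) +
      ∑ p ∈ (Finset.Icc 1 n ×ˢ Finset.Icc 1 n).filter (fun p => p.1 < p.2),
        (T p.1 p.2 : ℝ) * (if pathFee f p.1 p.2 ≤ 1 then 1 else 0) *
          ((⌊∑ k ∈ Finset.range p.2, f k + t⌋ : ℝ) - (⌊∑ k ∈ Finset.range p.1, f k + t⌋ : ℝ))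
      ≤ pathProfit n T (roundedFee f t) := by
  unfold pathProfit
  refine (add_le_add_iff_left _).2 (Finset.sum_le_sum fun p hp => ?_)
  simp only [Finset.mem_filter, Finset.mem_product, Finset.mem_Icc] at hp
  rw [mul_assoc, ← pathFee_roundedFee f t hp.2]
  refine mul_le_mul_of_nonneg_left ?_ (Nat.cast_nonneg _)
  split_ifs with h h' h'
  · simp
  · refine absurd ?_ h'
    rw [pathFee_roundedFee f t hp.2]
    rw [pathFee_eq_sum_range_sub f hp.2] at h
    exact floor_sub_floor_le_one (by linarith)
  · rw [zero_mul]
    refine Finset.sum_nonneg fun k hk => roundedFee_nonneg t (hf k ?_)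
    simp only [Finset.mem_Icc] at hk ⊢
    omega
  · simp

theorem pathProfit_le_of_forall_roundedFee_le {n : ℕ} (T : ℕ → ℕ → ℕ) {f : ℕ → ℝ} {M : ℝ}
    (hf : ∀ k ∈ Finset.Icc 1 (n - 1), 0 ≤ f k)
    (hM : ∀ t, pathProfit n T (roundedFee f t) ≤ M) : pathProfit n T f ≤ M := by
  have hfloor := fun p : ℕ × ℕ =>
    ((intervalIntegrable_floor_add (∑ k ∈ Finset.range p.2, f k)).sub
      (intervalIntegrable_floor_add (∑ k ∈ Finset.range p.1, f k))).const_mul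
        ((T p.1 p.2 : ℝ) * (if pathFee f p.1 p.2 ≤ 1 then 1 else 0))
  have hsum := IntervalIntegrable.sum
    ((Finset.Icc 1 n ×ˢ Finset.Icc 1 n).filter (fun p => p.1 < p.2)) fun p _ => hfloor p
  have hconst : IntervalIntegrable (fun _ : ℝ => -((n - 1 : ℕ) : ℝ)) MeasureTheory.volume 0 1 :=
    intervalIntegrable_const
  simp only [Finset.sum_fn] at hsum
  have hmono := intervalIntegral.integral_mono_on zero_le_one (hconst.add hsum)
    (intervalIntegrable_const (c := M)) fun t _ => (le_pathProfit_roundedFee T hf t).trans (hM t)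
  rw [intervalIntegral.integral_add hconst hsum,
    intervalIntegral.integral_finsetSum fun p _ => hfloor p] at hmono
  simp only [intervalIntegral.integral_const, sub_zero, one_smul] at hmono
  refine le_of_eq_of_le ?_ hmono
  unfold pathProfit
  congr 1
  refine Finset.sum_congr rfl fun p hp => ?_
  rw [intervalIntegral.integral_const_mul,
    intervalIntegral.integral_sub (intervalIntegrable_floor_add _) (intervalIntegrable_floor_add _),
    integral_floor_add, integral_floor_add,
    ← pathFee_eq_sum_range_sub f (Finset.mem_filter.1 hp).2]
  split_ifs <;> simp

/-- For every path graph and every transaction matrix, the maximum of the profit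
over fee assignments with values in `[0,1]` is attained at a `0/1`-valued fee
assignment. -/
theorem path_optimal_fees_zero_one (n : ℕ) (hn : 2 ≤ n)
    (T : ℕ → ℕ → ℕ) (hsymm : ∀ i j, T i j = T j i) (hdiag : ∀ i, T i i = 0) :
    ∃ fstar : ℕ → ℝ, (∀ k, fstar k = 0 ∨ fstar k = 1) ∧
      ∀ f : ℕ → ℝ, (∀ k ∈ Finset.Icc 1 (n - 1), 0 ≤ f k ∧ f k ≤ 1) →
        pathProfit n T f ≤ pathProfit n T fstar := by
  obtain ⟨A, -, hA⟩ := Finset.exists_max_image (Finset.Icc 1 (n - 1)).powerset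
    (fun A => pathProfit n T (fun k => if k ∈ A then 1 else 0)) ⟨∅, Finset.empty_mem_powerset _⟩
  refine ⟨fun k => if k ∈ A then 1 else 0, fun k => by by_cases h : k ∈ A <;> simp [h],
    fun f hf => ?_⟩
  refine pathProfit_le_of_forall_roundedFee_le T (fun k hk => (hf k hk).1) fun t => ?_
  classical
  refine le_of_eq_of_le (pathProfit_congr T fun k hk => ?_)
    (hA ((Finset.Icc 1 (n - 1)).filter fun k => roundedFee f t k = 1)
      (Finset.mem_powerset.2 (Finset.filter_subset _ _)))
  rcases roundedFee_eq_zero_or_one t (hf k hk).1 (hf k hk).2 with h | h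
  · simp [h]
  · simp only [Finset.mem_filter, hk, h, and_self, if_true]
end

section
/- Let m ≥ 1 and let S be a finite antichain of nonempty integer intervals contained in {1,…,m}; that is, each element of S is an interval [i,j] with 1 ≤ i ≤ j ≤ m, and no interval of S is contained in another interval of S. Then there exists a vector f′ ∈ {0,1}^m such that Σ_{k=i}^{j} f′_k = 1 for every interval [i,j] ∈ S. -/
/-- A finite antichain of nonempty integer intervals has a transversal, consisting of right
endpoints, that meets every interval in exactly one point. -/
theorem exists_finset_existsUnique_mem_Icc_of_antichain (S : Finset (ℕ × ℕ))
    (hS : ∀ p ∈ S, p.1 ≤ p.2)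
    (hanti : ∀ p ∈ S, ∀ q ∈ S, q.1 ≤ p.1 → p.2 ≤ q.2 → p = q) :
    ∃ T : Finset ℕ, (∀ t ∈ T, ∃ s ∈ S, s.2 = t) ∧
      ∀ p ∈ S, ∃! k, k ∈ Finset.Icc p.1 p.2 ∧ k ∈ T := by
  induction S using Finset.strongInduction with
  | H S ih =>
    obtain rfl | hne := S.eq_empty_or_nonempty
    · exact ⟨∅, by simp⟩
    obtain ⟨p, hp, hmin⟩ := S.exists_min_image Prod.snd hne
    obtain ⟨T, hT, hTS⟩ := ih (S.filter fun q => p.2 < q.1)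
      (Finset.filter_ssubset.2 ⟨p, hp, not_lt.2 (hS p hp)⟩)
      (fun q hq => hS q (Finset.mem_of_mem_filter q hq))
      (fun q hq s hs => hanti q (Finset.mem_of_mem_filter q hq) s (Finset.mem_of_mem_filter s hs))
    simp only [Finset.mem_filter] at hT hTS
    refine ⟨insert p.2 T, fun t ht => ?_, fun q hq => ?_⟩
    · obtain rfl | ht := Finset.mem_insert.1 ht
      · exact ⟨p, hp, rfl⟩
      · obtain ⟨s, hs, rfl⟩ := hT t ht
        exact ⟨s, hs.1, rfl⟩
    by_cases hpq : p.2 < q.1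
    · obtain ⟨k, ⟨hk, hkT⟩, huniq⟩ := hTS q ⟨hq, hpq⟩
      refine ⟨k, ⟨hk, Finset.mem_insert_of_mem hkT⟩, fun j ⟨hj, hjT⟩ => ?_⟩
      obtain rfl | hjT := Finset.mem_insert.1 hjT
      · exact absurd (Finset.mem_Icc.1 hj).1 (not_le.2 hpq)
      · exact huniq j ⟨hj, hjT⟩
    · refine ⟨p.2, ⟨Finset.mem_Icc.2 ⟨not_lt.1 hpq, hmin q hq⟩, Finset.mem_insert_self _ _⟩,
        fun j ⟨hj, hjT⟩ => ?_⟩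
      obtain rfl | hjT := Finset.mem_insert.1 hjT
      · rfl
      · obtain ⟨s, ⟨hs, hps⟩, rfl⟩ := hT j hjT
        have hsq : s = q := hanti s hs q hq ((not_lt.1 hpq).trans hps.le) (Finset.mem_Icc.1 hj).2
        exact absurd (hsq ▸ hps) hpq

/-- For `m ≥ 1` and a finite antichain `S` of nonempty integer intervals
`[i,j] ⊆ {1,…,m}` (represented by their endpoint pairs `(i,j)`), there is a
`0/1` vector `f'` whose sum over every interval of `S` is exactly `1`. -/
theorem exists_zero_one_vector_summing_to_one_on_antichain
    (m : ℕ) (hm : 1 ≤ m) (S : Finset (ℕ × ℕ))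
    (hS : ∀ p ∈ S, 1 ≤ p.1 ∧ p.1 ≤ p.2 ∧ p.2 ≤ m)
    (hanti : ∀ p ∈ S, ∀ q ∈ S, q.1 ≤ p.1 → p.2 ≤ q.2 → p = q) :
    ∃ f' : ℕ → ℝ, (∀ k, f' k = 0 ∨ f' k = 1) ∧
      ∀ p ∈ S, ∑ k ∈ Finset.Icc p.1 p.2, f' k = 1 := by
  obtain ⟨T, -, hT⟩ :=
    exists_finset_existsUnique_mem_Icc_of_antichain S (fun p hp => (hS p hp).2.1) hanti
  refine ⟨fun k => if k ∈ T then 1 else 0, fun k => by by_cases h : k ∈ T <;> simp [h],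
    fun p hp => ?_⟩
  obtain ⟨k, ⟨hk, hkT⟩, huniq⟩ := hT p hp
  rw [Finset.sum_eq_single_of_mem k hk fun j hj hjk =>
    if_neg fun hjT => hjk (huniq j ⟨hj, hjT⟩), if_pos hkT]
end

section
/- Let m ≥ 1 and let S be a finite antichain of nonempty integer intervals contained in {1,…,m}. Then every vector f ∈ [0,1]^m satisfying Σ_{k∈I} f_k ≤ 1 for every I ∈ S is a convex combination of vectors g ∈ {0,1}^m that also satisfy Σ_{k∈I} g_k ≤ 1 for every I ∈ S. Equivalently, every vertex of the polytope {f ∈ [0,1]^m : Σ_{k∈I} f_k ≤ 1 for all I ∈ S} has all coordinates in {0,1}. -/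
open MeasureTheory

/-- Differences of consecutive floors of the `θ`-shifted partial sums of `f`. -/
noncomputable def floorRounding (f : ℕ → ℝ) (θ : ℝ) (k : ℕ) : ℝ :=
  (⌊∑ i ∈ Finset.Icc 1 k, f i + θ⌋ : ℝ) - ⌊∑ i ∈ Finset.Icc 1 (k - 1), f i + θ⌋

lemma sum_Icc_floorRounding (f : ℕ → ℝ) (θ : ℝ) {a b : ℕ} (hab : a ≤ b) :
    ∑ k ∈ Finset.Icc a b, floorRounding f θ k =
      (⌊∑ i ∈ Finset.Icc 1 b, f i + θ⌋ : ℝ) - ⌊∑ i ∈ Finset.Icc 1 (a - 1), f i + θ⌋ := by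
  induction b, hab using Nat.le_induction with
  | base => simp [floorRounding]
  | succ b hb ih =>
    rw [Finset.sum_Icc_succ_top (by omega), ih, floorRounding]
    simp

lemma sum_Icc_one_add_sum_Icc (f : ℕ → ℝ) {a b : ℕ} (ha : 1 ≤ a) (hab : a ≤ b) :
    ∑ i ∈ Finset.Icc 1 b, f i =
      ∑ i ∈ Finset.Icc 1 (a - 1), f i + ∑ i ∈ Finset.Icc a b, f i := by
  induction b, hab using Nat.le_induction with
  | base =>
    obtain ⟨a, rfl⟩ := Nat.exists_eq_add_of_le' ha
    rw [Finset.sum_Icc_succ_top (by omega)]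
    simp
  | succ b hb ih =>
    rw [Finset.sum_Icc_succ_top (by omega), ih, Finset.sum_Icc_succ_top (by omega), add_assoc]

lemma floor_sub_floor_le_one_s2 {x y : ℝ} (h : y ≤ x + 1) : (⌊y⌋ : ℝ) - ⌊x⌋ ≤ 1 := by
  have := Int.floor_mono h
  rw [Int.floor_add_one] at this
  have : (⌊y⌋ : ℝ) ≤ ⌊x⌋ + 1 := by exact_mod_cast this
  linarith

lemma sum_Icc_floorRounding_le_one (f : ℕ → ℝ) (θ : ℝ) {a b : ℕ} (ha : 1 ≤ a) (hab : a ≤ b)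
    (h : ∑ i ∈ Finset.Icc a b, f i ≤ 1) : ∑ k ∈ Finset.Icc a b, floorRounding f θ k ≤ 1 := by
  rw [sum_Icc_floorRounding f θ hab]
  apply floor_sub_floor_le_one_s2
  rw [sum_Icc_one_add_sum_Icc f ha hab]
  linarith

lemma floorRounding_eq_zero_or_one (f : ℕ → ℝ) (θ : ℝ) {k : ℕ} (hk : 1 ≤ k)
    (h0 : 0 ≤ f k) (h1 : f k ≤ 1) : floorRounding f θ k = 0 ∨ floorRounding f θ k = 1 := by
  have hs := sum_Icc_one_add_sum_Icc f hk le_rfl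
  rw [Finset.Icc_self, Finset.sum_singleton] at hs
  have hle := floor_sub_floor_le_one_s2 (x := ∑ i ∈ Finset.Icc 1 (k - 1), f i + θ)
    (y := ∑ i ∈ Finset.Icc 1 k, f i + θ) (by linarith)
  have hge := Int.floor_mono (a := ∑ i ∈ Finset.Icc 1 (k - 1), f i + θ)
    (b := ∑ i ∈ Finset.Icc 1 k, f i + θ) (by linarith)
  rw [floorRounding]
  norm_cast at hle ⊢
  omega

lemma intervalIntegrable_fract_add (x a b : ℝ) :
    IntervalIntegrable (fun θ => Int.fract (x + θ)) volume a b := by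
  rw [intervalIntegrable_iff]
  refine Measure.integrableOn_of_bounded (M := 1) (by simp) ?_ ?_
  · exact (measurable_fract.comp (measurable_const_add x)).aestronglyMeasurable
  · refine Filter.Eventually.of_forall fun θ => ?_
    rw [Real.norm_of_nonneg (Int.fract_nonneg _)]
    exact (Int.fract_lt_one _).le

lemma integral_fract_add (x : ℝ) :
    ∫ θ in (0 : ℝ)..1, Int.fract (x + θ) = ∫ θ in (0 : ℝ)..1, Int.fract θ := by
  rw [intervalIntegral.integral_comp_add_left (fun θ => Int.fract θ)]
  simpa using (Int.fract_periodic ℝ).intervalIntegral_add_eq x 0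

lemma floorRounding_eq (f : ℕ → ℝ) {k : ℕ} (hk : 1 ≤ k) (θ : ℝ) :
    floorRounding f θ k = f k + (Int.fract (∑ i ∈ Finset.Icc 1 (k - 1), f i + θ) -
      Int.fract (∑ i ∈ Finset.Icc 1 k, f i + θ)) := by
  have hs := sum_Icc_one_add_sum_Icc f hk le_rfl
  rw [Finset.Icc_self, Finset.sum_singleton] at hs
  rw [floorRounding, Int.fract, Int.fract]
  linarith

lemma intervalIntegrable_floorRounding (f : ℕ → ℝ) {k : ℕ} (hk : 1 ≤ k) (a b : ℝ) :
    IntervalIntegrable (fun θ => floorRounding f θ k) volume a b := by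
  simp_rw [floorRounding_eq f hk]
  exact intervalIntegrable_const.add
    ((intervalIntegrable_fract_add _ _ _).sub (intervalIntegrable_fract_add _ _ _))

lemma integral_floorRounding (f : ℕ → ℝ) {k : ℕ} (hk : 1 ≤ k) :
    ∫ θ in (0 : ℝ)..1, floorRounding f θ k = f k := by
  simp_rw [floorRounding_eq f hk]
  rw [intervalIntegral.integral_add intervalIntegrable_const
    ((intervalIntegrable_fract_add _ _ _).sub (intervalIntegrable_fract_add _ _ _)),
    intervalIntegral.integral_sub (intervalIntegrable_fract_add _ _ _)
      (intervalIntegrable_fract_add _ _ _), integral_fract_add, integral_fract_add]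
  simp

/-- A vector in `[0,1]^m` lies in the convex hull of its floor roundings. -/
lemma mem_convexHull_range_floorRounding (m : ℕ) (f : ℕ → ℝ)
    (hf : ∀ k ∈ Finset.Icc 1 m, 0 ≤ f k ∧ f k ≤ 1) :
    (fun k : Fin m => f (k + 1)) ∈
      convexHull ℝ (Set.range fun (θ : ℝ) (k : Fin m) => floorRounding f θ (k + 1)) := by
  set V := Set.range fun (θ : ℝ) (k : Fin m) => floorRounding f θ (k + 1)
  have hV : V.Finite := by
    refine (Set.Finite.pi' (t := fun _ : Fin m => ({0, 1} : Set ℝ))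
      fun _ => Set.toFinite _).subset ?_
    rintro _ ⟨θ, rfl⟩ k
    have := hf (k + 1) (Finset.mem_Icc.2 ⟨by omega, by omega⟩)
    simpa using floorRounding_eq_zero_or_one f θ (Nat.le_add_left 1 k) this.1 this.2
  let μ : Measure ℝ := volume.restrict (Set.Ioc 0 1)
  have : IsProbabilityMeasure μ := ⟨by simp [μ]⟩
  have hint (k : Fin m) : Integrable (fun θ => floorRounding f θ (k + 1)) μ :=
    (intervalIntegrable_iff_integrableOn_Ioc_of_le zero_le_one).1
      (intervalIntegrable_floorRounding f (Nat.le_add_left 1 k) 0 1)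
  have hmem := (convex_convexHull ℝ V).integral_mem (hV.isClosed_convexHull ℝ)
    (Filter.Eventually.of_forall (p := fun θ : ℝ =>
      (fun k : Fin m => floorRounding f θ (k + 1)) ∈ convexHull ℝ V)
      fun θ => subset_convexHull ℝ V ⟨θ, rfl⟩) (μ := μ) (Integrable.of_eval hint)
  convert hmem using 1
  ext k
  rw [eval_integral hint, ← intervalIntegral.integral_of_le zero_le_one,
    integral_floorRounding f (Nat.le_add_left 1 k)]

/-- Every point of the polytope `{f ∈ [0,1]^m : ∑_{k∈I} f_k ≤ 1 for all I ∈ S}`,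
where `S` is an antichain of nonempty integer intervals inside `{1,…,m}`, is a
convex combination of `0/1` vectors lying in the same polytope. -/
theorem interval_antichain_polytope_integral
    (m : ℕ) (hm : 1 ≤ m) (S : Finset (ℕ × ℕ))
    (hS : ∀ p ∈ S, 1 ≤ p.1 ∧ p.1 ≤ p.2 ∧ p.2 ≤ m)
    (hanti : ∀ p ∈ S, ∀ q ∈ S, q.1 ≤ p.1 → p.2 ≤ q.2 → p = q)
    (f : ℕ → ℝ) (hf : ∀ k ∈ Finset.Icc 1 m, 0 ≤ f k ∧ f k ≤ 1)
    (hfS : ∀ p ∈ S, ∑ k ∈ Finset.Icc p.1 p.2, f k ≤ 1) :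
    ∃ (r : ℕ) (lam : Fin r → ℝ) (g : Fin r → ℕ → ℝ),
      (∀ t, 0 ≤ lam t) ∧ (∑ t, lam t = 1) ∧
      (∀ t, ∀ k, g t k = 0 ∨ g t k = 1) ∧
      (∀ t, ∀ p ∈ S, ∑ k ∈ Finset.Icc p.1 p.2, g t k ≤ 1) ∧
      (∀ k ∈ Finset.Icc 1 m, f k = ∑ t, lam t * g t k) := by
  obtain ⟨ι, _, w, z, hw0, hw1, hz, hsum⟩ :=
    mem_convexHull_iff_exists_fintype.1 (mem_convexHull_range_floorRounding m f hf)
  choose θ hθ using hz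
  let e := (Fintype.equivFin ι).symm
  refine ⟨Fintype.card ι, fun t => w (e t),
    fun t k => if k ∈ Finset.Icc 1 m then floorRounding f (θ (e t)) k else 0,
    fun t => hw0 _, ?_, ?_, ?_, ?_⟩
  · rw [← hw1]
    exact e.sum_comp w
  · intro t k
    dsimp only
    split_ifs with hk
    · exact floorRounding_eq_zero_or_one f _ (Finset.mem_Icc.1 hk).1 (hf k hk).1 (hf k hk).2
    · exact Or.inl rfl
  · intro t p hp
    obtain ⟨h1, h12, h2⟩ := hS p hp
    rw [Finset.sum_congr rfl fun k hk =>
      if_pos (Finset.Icc_subset_Icc h1 h2 hk)]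
    exact sum_Icc_floorRounding_le_one f _ h1 h12 (hfS p hp)
  · intro k hk
    obtain ⟨hk1, hkm⟩ := Finset.mem_Icc.1 hk
    obtain ⟨k, rfl⟩ := Nat.exists_eq_add_of_le' hk1
    have hk' := congrFun hsum ⟨k, by omega⟩
    simp only [if_pos hk]
    rw [e.sum_comp fun i => w i * floorRounding f (θ i) (k + 1), ← hk']
    simp [← hθ]
end

section
/- Let T be a transaction matrix on n nodes, let G_opt = (V_opt, E_opt) with fee assignment f_opt be a profit-maximizing payment network for T, and suppose G_opt is connected and contains all n nodes. Let S be the star graph on {1,…,n} plus an additional center node c, with an edge from c to every node i ∈ {1,…,n}, and let f_S assign fee 1/2 to every edge of S. Then p(S, T, f_S) ≥ p(G_opt, T, f_opt) − 1; that is, the star with uniform fees 1/2 achieves profit within 1 of the optimum. -/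
/-- Cheapest-path fee between `u` and `v` in `G` with fee assignment `f`:
the infimum of the total fee over all (simple) paths from `u` to `v`
(junk value `0` if no path exists, which contributes nothing to the profit). -/
noncomputable def minFee {V : Type*} (G : SimpleGraph V) (f : Sym2 V → ℝ) (u v : V) : ℝ :=
  sInf {x : ℝ | ∃ w : G.Walk u v, w.IsPath ∧ x = (w.edges.map f).sum}

/-- Profit of a payment network `G` (whose vertex set contains the `n` customer
nodes via the embedding `ι`) with fee assignment `f` and transaction matrix `T`. -/
noncomputable def netProfit {V : Type*} (G : SimpleGraph V) (f : Sym2 V → ℝ)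
    (n : ℕ) (ι : Fin n ↪ V) (T : Fin n → Fin n → ℕ) : ℝ :=
  -(G.edgeSet.ncard : ℝ) +
    ∑ p ∈ Finset.univ.filter (fun p : Fin n × Fin n => p.1 < p.2),
      (T p.1 p.2 : ℝ) *
        (if minFee G f (ι p.1) (ι p.2) ≤ 1 then minFee G f (ι p.1) (ι p.2) else 0)

/-- The star graph on the `n` customer nodes plus one additional center node
(the last element of `Fin (n+1)`), with an edge from the center to each node. -/
def starGraph (n : ℕ) : SimpleGraph (Fin (n + 1)) :=
  SimpleGraph.fromRel (fun x _ => x = Fin.last n)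

/-- The embedding of the `n` customer nodes into the star graph's vertex set. -/
def starEmb (n : ℕ) : Fin n ↪ Fin (n + 1) :=
  ⟨Fin.castSucc, Fin.castSucc_injective n⟩

theorem starGraph_adj_castSucc_iff {n : ℕ} {i : Fin n} {x : Fin (n + 1)} :
    (starGraph n).Adj i.castSucc x ↔ x = Fin.last n := by
  have h := (Fin.castSucc_lt_last i).ne
  simp only [starGraph, SimpleGraph.fromRel_adj, h, false_or, and_iff_right_iff_imp]
  rintro rfl
  exact h

theorem starGraph_edgeSet_ncard_le (n : ℕ) : (starGraph n).edgeSet.ncard ≤ n := by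
  have hsub : (starGraph n).edgeSet ⊆
      Set.range (fun i : Fin n => s(i.castSucc, Fin.last n)) := by
    intro e
    induction e using Sym2.ind with
    | _ x y =>
      intro h
      rw [SimpleGraph.mem_edgeSet] at h
      induction x using Fin.lastCases with
      | cast i => exact ⟨i, by rw [starGraph_adj_castSucc_iff.1 h]⟩
      | last =>
        induction y using Fin.lastCases with
        | cast j => exact ⟨j, Sym2.eq_swap⟩
        | last => exact absurd rfl h.ne
  calc (starGraph n).edgeSet.ncard
      ≤ (Set.range (fun i : Fin n => s(i.castSucc, Fin.last n))).ncard :=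
        Set.ncard_le_ncard hsub (Set.toFinite _)
    _ ≤ n := by
        rw [← Set.image_univ]
        simpa using Set.ncard_image_le (f := fun i : Fin n => s(i.castSucc, Fin.last n))
          (Set.toFinite Set.univ)

theorem starGraph_length_of_isPath {n : ℕ} {i j : Fin n} (hij : i ≠ j)
    (w : (starGraph n).Walk i.castSucc j.castSucc) (hw : w.IsPath) : w.length = 2 := by
  have hne : i.castSucc ≠ j.castSucc := fun h => hij (Fin.castSucc_injective n h)
  generalize hx : i.castSucc = x at w hne
  generalize hy : j.castSucc = y at w hne
  cases w with
  | nil => exact absurd rfl hne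
  | cons h w =>
    subst hx
    obtain rfl := starGraph_adj_castSucc_iff.1 h
    cases w with
    | nil => exact absurd hy (Fin.castSucc_lt_last j).ne
    | @cons _ z _ h' w =>
      cases w with
      | nil => rfl
      | cons h'' w =>
        induction z using Fin.lastCases with
        | last => exact absurd rfl h'.ne
        | cast k =>
          obtain rfl := starGraph_adj_castSucc_iff.1 h''
          simp [SimpleGraph.Walk.cons_isPath_iff] at hw

theorem minFee_starGraph {n : ℕ} {i j : Fin n} (hij : i ≠ j) :
    minFee (starGraph n) (fun _ => (1 : ℝ) / 2) (starEmb n i) (starEmb n j) = 1 := by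
  have hsum (w : (starGraph n).Walk i.castSucc j.castSucc) (hw : w.IsPath) :
      (w.edges.map fun _ => (1 : ℝ) / 2).sum = 1 := by
    norm_num [starGraph_length_of_isPath hij w hw]
  have hreach : (starGraph n).Reachable i.castSucc j.castSucc :=
    (starGraph_adj_castSucc_iff.2 rfl).reachable.trans
      (starGraph_adj_castSucc_iff.2 rfl).symm.reachable
  obtain ⟨w, hw⟩ := hreach.exists_isPath
  have hset : {x : ℝ | ∃ w : (starGraph n).Walk (starEmb n i) (starEmb n j),
      w.IsPath ∧ x = (w.edges.map fun _ => (1 : ℝ) / 2).sum} = {1} := by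
    ext x
    constructor
    · rintro ⟨w, hw, rfl⟩
      exact hsum w hw
    · rintro rfl
      exact ⟨w, hw, (hsum w hw).symm⟩
  rw [minFee, hset, csInf_singleton]

theorem le_netProfit_starGraph (n : ℕ) (T : Fin n → Fin n → ℕ) :
    -(n : ℝ) + ∑ p ∈ Finset.univ.filter (fun p : Fin n × Fin n => p.1 < p.2), (T p.1 p.2 : ℝ) ≤
      netProfit (starGraph n) (fun _ => (1 : ℝ) / 2) n (starEmb n) T := by
  refine add_le_add (neg_le_neg (by exact_mod_cast starGraph_edgeSet_ncard_le n))
    (Finset.sum_le_sum fun p hp => ?_)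
  rw [minFee_starGraph (Finset.mem_filter.1 hp).2.ne]
  simp

theorem netProfit_le_of_connected {V : Type*} [Finite V] {G : SimpleGraph V} (hG : G.Connected)
    (f : Sym2 V → ℝ) (n : ℕ) (ι : Fin n ↪ V) (T : Fin n → Fin n → ℕ) :
    netProfit G f n ι T ≤ 1 - (n : ℝ) +
      ∑ p ∈ Finset.univ.filter (fun p : Fin n × Fin n => p.1 < p.2), (T p.1 p.2 : ℝ) := by
  have hcard : n ≤ G.edgeSet.ncard + 1 := by
    have hV : n ≤ Nat.card V := by simpa using Nat.card_le_card_of_injective ι ι.injective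
    exact hV.trans hG.card_vert_le_card_edgeSet_add_one
  refine add_le_add ?_ (Finset.sum_le_sum fun p _ => ?_)
  · have : (n : ℝ) ≤ G.edgeSet.ncard + 1 := by exact_mod_cast hcard
    linarith
  · refine mul_le_of_le_one_right (Nat.cast_nonneg _) ?_
    split_ifs with h
    · exact h
    · exact zero_le_one

/-- If the optimal payment network (over all finite graphs containing the `n`
customer nodes and all fee assignments with values in `[0,1]`) is connected,
then the star with uniform fees `1/2` achieves profit within `1` of it. -/
theorem star_near_optimal (n : ℕ)
    (T : Fin n → Fin n → ℕ) (hsymm : ∀ i j, T i j = T j i) (hdiag : ∀ i, T i i = 0)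
    (V : Type) [Fintype V] (Gopt : SimpleGraph V) (ι : Fin n ↪ V)
    (fopt : Sym2 V → ℝ) (hfopt : ∀ e ∈ Gopt.edgeSet, 0 ≤ fopt e ∧ fopt e ≤ 1)
    (hconn : Gopt.Connected)
    (hmax : ∀ (V' : Type) [Fintype V'] (G' : SimpleGraph V') (ι' : Fin n ↪ V')
      (f' : Sym2 V' → ℝ), (∀ e ∈ G'.edgeSet, 0 ≤ f' e ∧ f' e ≤ 1) →
        netProfit G' f' n ι' T ≤ netProfit Gopt fopt n ι T) :
    netProfit Gopt fopt n ι T - 1 ≤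
      netProfit (starGraph n) (fun _ => (1 : ℝ) / 2) n (starEmb n) T := by
  linarith [netProfit_le_of_connected hconn fopt n ι T, le_netProfit_starGraph n T]
end

section
/- Let t ≥ 2 and let T be the transaction matrix on 3 nodes with T[i,j] = t for every pair of distinct nodes i ≠ j. Then the triangle graph on the 3 nodes with fee 1 on each of its 3 edges achieves profit 3t − 3, while every tree on the 3 nodes (i.e., every 2-edge path) with any fee assignment f ∈ [0,1]^2 achieves profit at most 2t − 2 < 3t − 3. Hence the optimal payment network for T is not a tree. -/
/-- The transaction matrix on `3` nodes with `t` transactions between every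
pair of distinct nodes. -/
def triT (t : ℕ) : Fin 3 → Fin 3 → ℕ := fun i j => if i = j then 0 else t

lemma minFee_eq_of_isPath {V : Type*} {G : SimpleGraph V} (hG : G.IsAcyclic) (f : Sym2 V → ℝ)
    {u v : V} (w : G.Walk u v) (hw : w.IsPath) : minFee G f u v = (w.edges.map f).sum := by
  have h : {x : ℝ | ∃ w : G.Walk u v, w.IsPath ∧ x = (w.edges.map f).sum} =
      {(w.edges.map f).sum} := by
    ext x
    constructor
    · rintro ⟨w', hw', rfl⟩
      have h' : w' = w := congrArg Subtype.val
        ((hG.subsingleton_path u v).elim ⟨w', hw'⟩ ⟨w, hw⟩)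
      rw [h', Set.mem_singleton_iff]
    · rintro rfl
      exact ⟨w, hw, rfl⟩
  rw [minFee, h, csInf_singleton]

lemma minFee_of_adj {V : Type*} {G : SimpleGraph V} (hG : G.IsAcyclic) (f : Sym2 V → ℝ)
    {u v : V} (h : G.Adj u v) : minFee G f u v = f s(u, v) := by
  rw [minFee_eq_of_isPath hG f (.cons h .nil) (by simp [h.ne])]
  simp

lemma minFee_of_adj_adj {V : Type*} {G : SimpleGraph V} (hG : G.IsAcyclic) (f : Sym2 V → ℝ)
    {u c v : V} (huc : G.Adj u c) (hcv : G.Adj c v) (huv : u ≠ v) :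
    minFee G f u v = f s(u, c) + f s(c, v) := by
  rw [minFee_eq_of_isPath hG f (.cons huc (.cons hcv .nil)) (by simp [huc.ne, hcv.ne, huv])]
  simp

lemma minFee_top_one {V : Type*} {u v : V} (huv : u ≠ v) :
    minFee (⊤ : SimpleGraph V) (fun _ => (1 : ℝ)) u v = 1 := by
  refine IsLeast.csInf_eq ⟨⟨.cons (by simpa using huv) .nil, by simp [huv], by simp⟩, ?_⟩
  rintro x ⟨w, -, rfl⟩
  have h : 0 < w.length := by
    rw [Nat.pos_iff_ne_zero]
    exact fun h => huv (SimpleGraph.Walk.eq_of_length_eq_zero h)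
  simp only [List.map_const', List.sum_replicate, SimpleGraph.Walk.length_edges, nsmul_eq_mul,
    mul_one]
  exact_mod_cast h

lemma netProfit_triT (G : SimpleGraph (Fin 3)) (f : Sym2 (Fin 3) → ℝ) (t : ℕ) :
    netProfit G f 3 (Function.Embedding.refl (Fin 3)) (triT t) =
      -(G.edgeSet.ncard : ℝ) + t * ((if minFee G f 0 1 ≤ 1 then minFee G f 0 1 else 0) +
        (if minFee G f 0 2 ≤ 1 then minFee G f 0 2 else 0) +
        (if minFee G f 1 2 ≤ 1 then minFee G f 1 2 else 0)) := by
  have h : Finset.univ.filter (fun p : Fin 3 × Fin 3 => p.1 < p.2) =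
      {(0, 1), (0, 2), (1, 2)} := by decide
  rw [netProfit, h, Finset.sum_insert (by decide), Finset.sum_insert (by decide),
    Finset.sum_singleton]
  simp only [triT, Function.Embedding.refl_apply]
  simp only [show ((0 : Fin 3) = 1) = False by decide, show ((0 : Fin 3) = 2) = False by decide,
    show ((1 : Fin 3) = 2) = False by decide, if_false]
  ring

/-- The collected fees of the three pairs on a two-edge path with edge fees `x` and `y`. -/
lemma path_fees_le_two {x y : ℝ} (hx : x ≤ 1) (hy : y ≤ 1) :
    x + y + (if x + y ≤ 1 then x + y else 0) ≤ 2 := by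
  split_ifs <;> linarith

lemma exists_center {G : SimpleGraph (Fin 3)} (hG : G.Connected) :
    (G.Adj 0 1 ∧ G.Adj 0 2) ∨ (G.Adj 0 1 ∧ G.Adj 1 2) ∨ (G.Adj 0 2 ∧ G.Adj 1 2) := by
  have h (v : Fin 3) : ∃ w, G.Adj v w := hG.preconnected.exists_adj_of_nontrivial v
  have h0 := h 0
  have h1 := h 1
  have h2 := h 2
  simp [Fin.exists_fin_succ] at h0 h1 h2
  rw [G.adj_comm 1 0] at h1
  rw [G.adj_comm 2 0, G.adj_comm 2 1] at h2
  tauto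

/-- For `t ≥ 2` transactions between each pair of three nodes, the triangle
with fee `1` on each edge achieves profit `3t - 3`, while every tree on the
three nodes with any `[0,1]` fee assignment achieves profit at most
`2t - 2 < 3t - 3`; hence the optimal payment network is not a tree. -/
theorem triangle_beats_trees (t : ℕ) (ht : 2 ≤ t) :
    netProfit (⊤ : SimpleGraph (Fin 3)) (fun _ => (1 : ℝ)) 3
        (Function.Embedding.refl (Fin 3)) (triT t) = 3 * (t : ℝ) - 3 ∧
    (∀ (G : SimpleGraph (Fin 3)) (f : Sym2 (Fin 3) → ℝ), G.IsTree →
      (∀ e ∈ G.edgeSet, 0 ≤ f e ∧ f e ≤ 1) →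
        netProfit G f 3 (Function.Embedding.refl (Fin 3)) (triT t) ≤
          2 * (t : ℝ) - 2) ∧
    2 * (t : ℝ) - 2 < 3 * (t : ℝ) - 3 := by
  have ht' : (2 : ℝ) ≤ t := by exact_mod_cast ht
  refine ⟨?_, fun G f hG hf => ?_, by linarith⟩
  · have hcard : (⊤ : SimpleGraph (Fin 3)).edgeSet.ncard = 3 := by
      rw [← SimpleGraph.coe_edgeFinset, Set.ncard_coe_finset]
      decide
    rw [netProfit_triT, hcard, minFee_top_one (by decide), minFee_top_one (by decide),
      minFee_top_one (by decide)]
    norm_num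
    ring
  · classical
    have hcard : G.edgeSet.ncard = 2 := by
      have h := hG.card_edgeFinset
      rw [← SimpleGraph.coe_edgeFinset, Set.ncard_coe_finset]
      simpa using h
    have hle {u v : Fin 3} (h : G.Adj u v) : f s(u, v) ≤ 1 := (hf _ h).2
    rw [netProfit_triT, hcard]
    suffices h : (if minFee G f 0 1 ≤ 1 then minFee G f 0 1 else 0) +
        (if minFee G f 0 2 ≤ 1 then minFee G f 0 2 else 0) +
        (if minFee G f 1 2 ≤ 1 then minFee G f 1 2 else 0) ≤ 2 by
      push_cast
      nlinarith
    rcases exists_center hG.connected with ⟨ha, hb⟩ | ⟨ha, hb⟩ | ⟨ha, hb⟩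
    · rw [minFee_of_adj hG.isAcyclic f ha, minFee_of_adj hG.isAcyclic f hb,
        minFee_of_adj_adj hG.isAcyclic f ha.symm hb (by decide), Sym2.eq_swap (a := 1),
        if_pos (hle ha), if_pos (hle hb)]
      exact path_fees_le_two (hle ha) (hle hb)
    · rw [minFee_of_adj hG.isAcyclic f ha, minFee_of_adj hG.isAcyclic f hb,
        minFee_of_adj_adj hG.isAcyclic f ha hb (by decide), if_pos (hle ha), if_pos (hle hb)]
      linarith [path_fees_le_two (hle ha) (hle hb)]
    · rw [minFee_of_adj hG.isAcyclic f ha, minFee_of_adj hG.isAcyclic f hb,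
        minFee_of_adj_adj hG.isAcyclic f ha hb.symm (by decide), Sym2.eq_swap (a := 2),
        if_pos (hle ha), if_pos (hle hb)]
      linarith [path_fees_le_two (hle ha) (hle hb)]
end
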